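/- Let ν ∈ [0,1), −(1−ν)/2 < κ < 0, l > 1/(1+κ−ν), k₁ > 0 and k₂ > h(l,κ,ν,k₁) be given, where h(l,κ,ν,k₁) := (2l(1+κ−ν)²/((l+1)(1+κ−ν)+κ)) · 2^{(l−1)((l+1)(1+κ−ν)+κ)/(l(1+κ−ν))} · k₁^{1/(1+κ−ν)}. Then the origin 0 ∈ ℝ² is small-time stable for the modified double integrator system ẋ₁ = |x₁|^ν x₂, ẋ₂ = u with the feedback law u(x₁,x₂) = −k₂ ⌊⌊x₂⌉^l − ⌊x̄₂⌉^l⌉^{(1+2κ−ν)/(l(1+κ−ν))}, where x̄₂ = x̄₂(x₁) := −k₁ ⌊x₁⌉^{1+κ−ν}. -/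

import Mathlib

open Set Filter

/-- Signed power: `⌊x⌉^a = sign(x) * |x|^a`. -/
noncomputable def spow (x a : ℝ) : ℝ := Real.sign x * |x| ^ a

/-- Dilation `Λ_r(l, x) = (l^{r₁} x₁, …, l^{rₙ} xₙ)`. -/
noncomputable def dil {n : ℕ} (r : Fin n → ℝ) (l : ℝ) (x : Fin n → ℝ) : Fin n → ℝ :=
  fun i => l ^ r i * x i

/-- `x` is a solution of `ẋ = F(x)` on `[s, ∞)`. -/
def IsSolOn {E : Type*} [NormedAddCommGroup E] [NormedSpace ℝ E]
    (F : E → E) (x : ℝ → E) (s : ℝ) : Prop :=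
  ∀ t ∈ Set.Ici s, HasDerivWithinAt x (F (x t)) (Set.Ici s) t

/-- The origin is (locally) asymptotically stable for `ẋ = F(x)`. -/
def AsympStable {E : Type*} [NormedAddCommGroup E] [NormedSpace ℝ E] (F : E → E) : Prop :=
  (∀ ε > 0, ∃ η > 0, ∀ x : ℝ → E, IsSolOn F x 0 → ‖x 0‖ < η → ∀ t ≥ 0, ‖x t‖ < ε) ∧
  (∃ δ > 0, ∀ x : ℝ → E, IsSolOn F x 0 → ‖x 0‖ < δ →
    Filter.Tendsto x Filter.atTop (nhds 0))

/-- The origin is small-time stable for `ẋ = F(x)`. -/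
def SmallTimeStable {E : Type*} [NormedAddCommGroup E] [NormedSpace ℝ E] (F : E → E) : Prop :=
  ∀ ε > 0, ∃ η > 0, ∀ x : ℝ → E, IsSolOn F x 0 → ‖x 0‖ < η →
    x ε = 0 ∧ ∀ t ≥ 0, ‖x t‖ < ε

/-- The gain bound `h(l,κ,ν,k)`. -/
noncomputable def hGain (l κ ν k : ℝ) : ℝ :=
  2*l*(1+κ-ν)^2 / ((l+1)*(1+κ-ν)+κ) *
    2 ^ ((l-1)*((l+1)*(1+κ-ν)+κ) / (l*(1+κ-ν))) * k ^ (1/(1+κ-ν))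

/-! ### The signed power -/

theorem spow_eq_max {a : ℝ} (ha : 0 < a) (x : ℝ) :
    spow x a = (max x 0) ^ a - (max (-x) 0) ^ a := by
  unfold spow
  rcases lt_trichotomy x 0 with h | rfl | h
  · rw [Real.sign_of_neg h, abs_of_neg h, max_eq_right h.le, max_eq_left (by linarith),
      Real.zero_rpow ha.ne']
    ring
  · simp
  · rw [Real.sign_of_pos h, abs_of_pos h, max_eq_left h.le, max_eq_right (by linarith),
      Real.zero_rpow ha.ne']
    ring

theorem spow_zero_left (a : ℝ) : spow 0 a = 0 := by simp [spow]

theorem spow_of_pos {x : ℝ} (hx : 0 < x) (a : ℝ) : spow x a = x ^ a := by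
  simp [spow, Real.sign_of_pos hx, abs_of_pos hx]

theorem spow_neg_left (x a : ℝ) : spow (-x) a = -spow x a := by
  simp [spow, Real.sign_neg]

theorem continuous_spow {a : ℝ} (ha : 0 < a) : Continuous fun x => spow x a := by
  simp_rw [spow_eq_max ha]
  exact ((continuous_id.max continuous_const).rpow_const fun _ => Or.inr ha.le).sub
    ((continuous_neg.max continuous_const).rpow_const fun _ => Or.inr ha.le)

theorem strictMono_spow {a : ℝ} (ha : 0 < a) : StrictMono fun x => spow x a := by
  intro x y hxy
  simp only [spow_eq_max ha]
  have h₁ : (max x 0) ^ a ≤ (max y 0) ^ a :=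
    Real.rpow_le_rpow (le_max_right _ _) (max_le_max hxy.le le_rfl) ha.le
  have h₂ : (max (-y) 0) ^ a ≤ (max (-x) 0) ^ a :=
    Real.rpow_le_rpow (le_max_right _ _) (max_le_max (by linarith) le_rfl) ha.le
  rcases lt_or_ge 0 y with hy | hy
  · have : (max x 0) ^ a < (max y 0) ^ a :=
      Real.rpow_lt_rpow (le_max_right _ _)
        (by rw [max_eq_left hy.le]; exact max_lt hxy hy) ha
    linarith
  · have : (max (-y) 0) ^ a < (max (-x) 0) ^ a :=
      Real.rpow_lt_rpow (le_max_right _ _)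
        (by rw [max_eq_left (by linarith), max_eq_left (by linarith)]; linarith) ha
    linarith

theorem spow_mul_of_pos {c : ℝ} (hc : 0 < c) (x a : ℝ) :
    spow (c * x) a = c ^ a * spow x a := by
  have hs : Real.sign (c * x) = Real.sign x := by
    rcases lt_trichotomy x 0 with h | rfl | h
    · rw [Real.sign_of_neg h, Real.sign_of_neg (mul_neg_of_pos_of_neg hc h)]
    · simp
    · rw [Real.sign_of_pos h, Real.sign_of_pos (mul_pos hc h)]
  rw [spow, spow, hs, abs_mul, abs_of_pos hc, Real.mul_rpow hc.le (abs_nonneg x)]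
  ring

theorem spow_spow (x a b : ℝ) : spow (spow x a) b = spow x (a * b) := by
  rcases lt_trichotomy x 0 with h | rfl | h
  · obtain ⟨y, rfl⟩ : ∃ y, x = -y := ⟨-x, by ring⟩
    have hy : 0 < y := by linarith
    rw [spow_neg_left, spow_neg_left, spow_neg_left, spow_of_pos hy, spow_of_pos (by positivity),
      spow_of_pos hy, Real.rpow_mul hy.le]
  · simp [spow]
  · rw [spow_of_pos h, spow_of_pos (by positivity), spow_of_pos h, Real.rpow_mul h.le]

theorem mul_spow_self {b : ℝ} (hb : 0 < b) (x : ℝ) : x * spow x b = |x| ^ (1 + b) := by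
  have hx : x * Real.sign x = |x| := by
    rcases lt_trichotomy x 0 with h | rfl | h
    · rw [Real.sign_of_neg h, abs_of_neg h]; ring
    · simp
    · rw [Real.sign_of_pos h, abs_of_pos h]; ring
  rw [spow, ← mul_assoc, hx, Real.rpow_add' (abs_nonneg x) (by linarith), Real.rpow_one]

/-! ### Differential inequalities -/

/-- A power `|x| ^ q` with `q > 1 - ν` is right differentiable along `ẋ = |x| ^ ν w`, even at the
times where `x` vanishes. -/
theorem hasDerivWithinAt_abs_rpow {x w : ℝ → ℝ} {ν q : ℝ} (hq : 0 < q) (hqν : 0 < q - 1 + ν)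
    (hx : ∀ t ∈ Ici (0 : ℝ), HasDerivWithinAt x (|x t| ^ ν * w t) (Ici 0) t)
    (hw : ContinuousOn w (Ici 0)) {t : ℝ} (ht : 0 ≤ t) :
    HasDerivWithinAt (fun s => |x s| ^ q) (q * spow (x t) (q - 1 + ν) * w t) (Ici t) t := by
  have hreg : ∀ s ∈ Ici (0 : ℝ), x s ≠ 0 →
      HasDerivWithinAt (fun s => |x s| ^ q) (q * spow (x s) (q - 1 + ν) * w s) (Ici 0) s := by
    intro s hs hxs
    have h₁ := ((hasDerivAt_abs hxs).comp_hasDerivWithinAt s (hx s hs)).rpow_const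
      (p := q) (Or.inl (abs_ne_zero.mpr hxs))
    refine h₁.congr_deriv ?_
    have hpos : 0 < |x s| := abs_pos.mpr hxs
    have hpow : |x s| ^ (q - 1 + ν) = |x s| ^ ν * |x s| ^ (q - 1) := by
      rw [← Real.rpow_add hpos]; congr 1; ring
    have hsign : ((SignType.sign (x s) : SignType) : ℝ) = Real.sign (x s) := by
      rcases lt_or_gt_of_ne hxs with h | h
      · simp [h, Real.sign_of_neg h]
      · simp [h, Real.sign_of_pos h]
    simp only [Function.comp_apply]
    rw [spow, hpow, hsign]
    ring
  by_cases hxt : x t = 0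
  swap
  · exact (hreg t ht hxt).mono (Ici_subset_Ici.mpr ht)
  have hxc : ContinuousOn x (Ici 0) := fun s hs => (hx s hs).continuousWithinAt
  have hfc : ContinuousOn (fun s => |x s| ^ q) (Ici 0) :=
    hxc.abs.rpow_const fun _ _ => Or.inr hq.le
  have hgc : ContinuousOn (fun s => q * spow (x s) (q - 1 + ν) * w s) (Ici 0) :=
    (continuousOn_const.mul ((continuous_spow hqν).comp_continuousOn hxc)).mul hw
  rw [hxt, spow_zero_left, mul_zero, zero_mul, hasDerivWithinAt_iff_isLittleO,
    Asymptotics.isLittleO_iff]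
  intro c hc
  have hsmall : ∀ᶠ s in nhdsWithin t (Ici t), |q * spow (x s) (q - 1 + ν) * w s| < c := by
    have h := ((hgc t ht).mono (Ici_subset_Ici.mpr ht)).abs
    refine h.eventually_lt_const ?_
    simpa [hxt, spow_zero_left] using hc
  obtain ⟨r, hr, hball⟩ := (nhdsGE_basis t).eventually_iff.mp hsmall
  filter_upwards [(nhdsGE_basis t).mem_of_mem hr] with s hs
  simp only [hxt, abs_zero, Real.zero_rpow hq.ne', sub_zero, smul_zero, Real.norm_eq_abs]
  by_cases hxs : x s = 0
  · simp only [hxs, abs_zero, Real.zero_rpow hq.ne']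
    positivity
  have hsub : Icc t s ⊆ Ici 0 := fun y hy => ht.trans hy.1
  have hcomp : IsCompact (Icc t s ∩ x ⁻¹' {0}) :=
    isCompact_Icc.of_isClosed_subset
      ((hxc.mono hsub).preimage_isClosed_of_isClosed isClosed_Icc isClosed_singleton)
      inter_subset_left
  obtain ⟨t₁, ⟨ht₁, hxt₁⟩, hmax⟩ := hcomp.exists_isGreatest ⟨t, ⟨le_rfl, hs.1⟩, hxt⟩
  have hxt₁' : x t₁ = 0 := hxt₁
  have hlt : t₁ < s := lt_of_le_of_ne ht₁.2 fun h => hxs (h ▸ hxt₁')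
  obtain ⟨y, hy, hslope⟩ := exists_hasDerivAt_eq_slope (fun s => |x s| ^ q)
    (fun s => q * spow (x s) (q - 1 + ν) * w s) hlt
    (hfc.mono fun z hz => ht.trans (ht₁.1.trans hz.1)) fun z hz => by
      have hz0 : 0 < z := (ht.trans ht₁.1).trans_lt hz.1
      refine (hreg z hz0.le fun h0 => ?_).hasDerivAt (Ici_mem_nhds hz0)
      exact absurd (hmax ⟨⟨ht₁.1.trans hz.1.le, hz.2.le⟩, h0⟩) (not_le.mpr hz.1)
  have hbd := hball ⟨ht₁.1.trans hy.1.le, hy.2.trans hs.2⟩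
  simp only [hxt₁', abs_zero, Real.zero_rpow hq.ne', sub_zero] at hslope
  rw [eq_div_iff (by linarith)] at hslope
  rw [← hslope, abs_mul, abs_of_pos (sub_pos.mpr hlt), abs_of_nonneg (sub_nonneg.mpr hs.1)]
  exact mul_le_mul hbd.le (by linarith [ht₁.1]) (sub_pos.mpr hlt).le hc.le

theorem le_of_right_deriv_nonpos {f f' : ℝ → ℝ} (hf : ContinuousOn f (Ici 0))
    (hf' : ∀ t, 0 ≤ t → HasDerivWithinAt f (f' t) (Ici t) t) (hneg : ∀ t, 0 ≤ t → f' t ≤ 0)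
    {s t : ℝ} (hs : 0 ≤ s) (hst : s ≤ t) : f t ≤ f s :=
  image_le_of_deriv_right_le_deriv_boundary (a := s) (b := t) (B := fun _ => f s)
    (B' := fun _ => 0) (hf.mono fun _ hy => hs.trans hy.1)
    (fun y hy => hf' y (hs.trans hy.1)) le_rfl continuousOn_const
    (fun y _ => hasDerivWithinAt_const y _ _) (fun y hy => hneg y (hs.trans hy.1)) ⟨hst, le_rfl⟩

/-- Finite-time extinction for `f' ≤ -c f ^ θ` with `θ < 1`. -/
theorem eq_zero_of_right_deriv_le_neg_rpow {f f' : ℝ → ℝ} {c θ T : ℝ} (hc : 0 < c) (hθ : θ < 1)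
    (hT : 0 ≤ T) (hf : ContinuousOn f (Ici 0))
    (hf' : ∀ t, 0 ≤ t → HasDerivWithinAt f (f' t) (Ici t) t) (hf0 : ∀ t, 0 ≤ t → 0 ≤ f t)
    (hle : ∀ t, 0 ≤ t → f' t ≤ -c * f t ^ θ) (hinit : f 0 ^ (1 - θ) < (1 - θ) * c * T) :
    f T = 0 := by
  by_contra hne
  have hTpos : 0 < f T := lt_of_le_of_ne (hf0 T hT) (Ne.symm hne)
  have hpos : ∀ t ∈ Icc 0 T, 0 < f t := fun t ht =>
    hTpos.trans_le <| le_of_right_deriv_nonpos hf hf' (fun s hs => (hle s hs).trans (by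
      have := Real.rpow_nonneg (hf0 s hs) θ
      nlinarith)) ht.1 ht.2
  have key := image_le_of_deriv_right_le_deriv_boundary (a := 0) (b := T)
    (f := fun t => f t ^ (1 - θ)) (f' := fun t => f' t * (1 - θ) * f t ^ (1 - θ - 1))
    (B := fun t => f 0 ^ (1 - θ) + -((1 - θ) * c) * t) (B' := fun _ => -((1 - θ) * c))
    ((hf.mono fun _ hy => hy.1).rpow_const fun y hy => Or.inl (hpos y hy).ne')
    (fun y hy => (hf' y hy.1).rpow_const (Or.inl (hpos y ⟨hy.1, hy.2.le⟩).ne'))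
    (by simp) (by fun_prop)
    (fun y _ => by
      simpa using (((hasDerivAt_id y).const_mul (-((1 - θ) * c))).const_add
        (f 0 ^ (1 - θ))).hasDerivWithinAt)
    (fun y hy => by
      have hy0 := hpos y ⟨hy.1, hy.2.le⟩
      have hcancel : f y ^ θ * f y ^ (1 - θ - 1) = 1 := by
        rw [← Real.rpow_add hy0]; simp
      calc f' y * (1 - θ) * f y ^ (1 - θ - 1)
          ≤ (-c * f y ^ θ) * (1 - θ) * f y ^ (1 - θ - 1) := by
            have := hle y hy.1
            have : 0 < 1 - θ := by linarith
            gcongr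
        _ = -((1 - θ) * c) * (f y ^ θ * f y ^ (1 - θ - 1)) := by ring
        _ = -((1 - θ) * c) := by rw [hcancel, mul_one])
    (right_mem_Icc.mpr hT)
  have := Real.rpow_nonneg (hf0 T hT) (1 - θ)
  linarith

/-! ### Compactness -/

theorem IsCompact.exists_pos_forall_le_neg {X : Type*} [TopologicalSpace X] {S : Set X}
    (hS : IsCompact S) {f : X → ℝ} (hf : ContinuousOn f S) (hneg : ∀ x ∈ S, f x < 0) :
    ∃ c > 0, ∀ x ∈ S, f x ≤ -c := by
  rcases S.eq_empty_or_nonempty with rfl | hne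
  · exact ⟨1, one_pos, by simp⟩
  · obtain ⟨y, hy, hmax⟩ := hS.exists_isMaxOn hne hf
    exact ⟨-f y, by linarith [hneg y hy], fun x hx => by simpa using hmax hx⟩

/-- If `g ≤ 0` on a compact set and `h < 0` where `g` vanishes, then `g + δ h` is uniformly
negative for some small `δ > 0`. -/
theorem IsCompact.exists_pos_add_mul_le_neg {X : Type*} [TopologicalSpace X] {S : Set X}
    (hS : IsCompact S) {g h : X → ℝ} (hg : Continuous g) (hh : Continuous h)
    (hg0 : ∀ x ∈ S, g x ≤ 0) (hgh : ∀ x ∈ S, g x = 0 → h x < 0) {δ₀ : ℝ} (hδ₀ : 0 < δ₀) :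
    ∃ δ > 0, δ ≤ δ₀ ∧ ∃ c > 0, ∀ x ∈ S, g x + δ * h x ≤ -c := by
  have hA : IsCompact (S ∩ {x | 0 ≤ h x}) := hS.inter_right (isClosed_le continuous_const hh)
  obtain ⟨m, hm, hgm⟩ := hA.exists_pos_forall_le_neg hg.continuousOn fun x hx =>
    lt_of_le_of_ne (hg0 x hx.1) fun h0 => absurd (hgh x hx.1 h0) (not_lt.mpr hx.2)
  obtain ⟨M, hM⟩ := hS.exists_bound_of_continuousOn hh.continuousOn
  have hM' : 0 < |M| + 1 := by positivity
  refine ⟨min δ₀ (m / (2 * (|M| + 1))), by positivity, min_le_left _ _, ?_⟩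
  set δ := min δ₀ (m / (2 * (|M| + 1)))
  have hδ : 0 < δ := by positivity
  refine hS.exists_pos_forall_le_neg (by fun_prop) fun x hx => ?_
  rcases le_or_gt 0 (h x) with h0 | h0
  · have h₁ := hgm x ⟨hx, h0⟩
    have h₂ : h x ≤ |M| + 1 :=
      (le_abs_self _).trans ((hM x hx).trans ((le_abs_self M).trans (by linarith)))
    have h₃ : δ * (2 * (|M| + 1)) ≤ m := (le_div_iff₀ (by positivity)).mp (min_le_right _ _)
    nlinarith [mul_le_mul_of_nonneg_left h₂ hδ.le]
  · nlinarith [hg0 x hx, mul_neg_of_pos_of_neg hδ h0]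

/-! ### Homogeneous second-order feedback -/

/-- The energy `x₂² / 2 + K |x₁| ^ (2a) / (2a)`. -/
noncomputable def energy (a K : ℝ) (p : ℝ × ℝ) : ℝ := p.2 ^ 2 / 2 + K / (2 * a) * |p.1| ^ (2 * a)

section Energy

variable {a K : ℝ}

theorem continuous_energy (ha : 0 < a) : Continuous (energy a K) := by
  have h : Continuous fun p : ℝ × ℝ => |p.1| ^ (2 * a) :=
    continuous_fst.abs.rpow_const fun _ => Or.inr (by positivity)
  unfold energy
  fun_prop

theorem energy_nonneg (ha : 0 < a) (hK : 0 < K) (p : ℝ × ℝ) : 0 ≤ energy a K p := by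
  unfold energy; positivity

theorem norm_lt_of_energy_lt (ha : 0 < a) (hK : 0 < K) {ε : ℝ} (hε : 0 < ε) {p : ℝ × ℝ}
    (hp : energy a K p < min (ε ^ 2 / 2) (K / (2 * a) * ε ^ (2 * a))) : ‖p‖ < ε := by
  have h₁ := hp.trans_le (min_le_left _ _)
  have h₂ := hp.trans_le (min_le_right _ _)
  unfold energy at h₁ h₂
  rw [Prod.norm_def, max_lt_iff, Real.norm_eq_abs, Real.norm_eq_abs]
  constructor
  · by_contra! h
    have := Real.rpow_le_rpow hε.le h (by positivity : 0 ≤ 2 * a)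
    have := mul_le_mul_of_nonneg_left this (by positivity : 0 ≤ K / (2 * a))
    nlinarith [sq_nonneg p.2]
  · have h₃ : 0 ≤ K / (2 * a) * |p.1| ^ (2 * a) := by positivity
    exact abs_lt_of_sq_lt_sq (by linarith) hε.le

theorem energy_pos (ha : 0 < a) (hK : 0 < K) {p : ℝ × ℝ} (hp : p ≠ 0) : 0 < energy a K p := by
  refine lt_of_not_ge fun h => ?_
  have hn : 0 < ‖p‖ := norm_pos_iff.mpr hp
  exact lt_irrefl _ (norm_lt_of_energy_lt ha hK hn (h.trans_lt (by positivity)))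

theorem energy_zero (ha : 0 < a) : energy a K 0 = 0 := by
  simp [energy, Real.zero_rpow (by positivity : 2 * a ≠ 0)]

theorem isCompact_energy_eq_one (ha : 0 < a) (hK : 0 < K) :
    IsCompact {p : ℝ × ℝ | energy a K p = 1} := by
  refine Metric.isCompact_of_isClosed_isBounded
    (isClosed_eq (continuous_energy ha) continuous_const) ?_
  have h₁ : Tendsto (fun ε : ℝ => ε ^ 2 / 2) atTop atTop :=
    (tendsto_pow_atTop two_ne_zero).atTop_div_const two_pos
  have h₂ : Tendsto (fun ε : ℝ => K / (2 * a) * ε ^ (2 * a)) atTop atTop :=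
    (tendsto_rpow_atTop (by positivity)).const_mul_atTop (by positivity)
  obtain ⟨ε, hε₁, hε₂, hε⟩ := ((h₁.eventually_gt_atTop 1).and
    ((h₂.eventually_gt_atTop 1).and (eventually_gt_atTop 0))).exists
  refine Metric.isBounded_ball (x := (0 : ℝ × ℝ)) (r := ε) |>.subset fun p hp => ?_
  rw [mem_ball_zero_iff]
  refine norm_lt_of_energy_lt ha hK hε ?_
  rw [show energy a K p = 1 from hp]
  exact lt_min hε₁ hε₂

theorem energy_dil {r : ℝ} (hr : 0 < r) (p : ℝ × ℝ) :
    energy a K (r * p.1, r ^ a * p.2) = r ^ (2 * a) * energy a K p := by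
  have h : r ^ (2 * a) = (r ^ a) ^ 2 := by
    rw [mul_comm, Real.rpow_mul hr.le]; norm_cast
  simp only [energy, abs_mul, abs_of_pos hr, Real.mul_rpow hr.le (abs_nonneg _), h]
  ring

/-- A homogeneous function is controlled by its values on the level set `energy = 1`. -/
theorem le_mul_energy_rpow (ha : 0 < a) (hK : 0 < K) {H : ℝ × ℝ → ℝ} {d C : ℝ}
    (hH : ∀ r : ℝ, 0 < r → ∀ p : ℝ × ℝ, H (r * p.1, r ^ a * p.2) = r ^ d * H p)
    (hC : ∀ p, energy a K p = 1 → H p ≤ C) {p : ℝ × ℝ} (hp : p ≠ 0) :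
    H p ≤ C * energy a K p ^ (d / (2 * a)) := by
  have hE := energy_pos (a := a) ha hK hp
  set r : ℝ := energy a K p ^ (-(1 / (2 * a))) with hr
  have hr0 : 0 < r := by positivity
  have h₁ : r ^ (2 * a) * energy a K p = 1 := by
    rw [hr, ← Real.rpow_mul hE.le]
    have : -(1 / (2 * a)) * (2 * a) = -1 := by field_simp
    rw [this, Real.rpow_neg_one, inv_mul_cancel₀ hE.ne']
  have h₂ := hC _ ((energy_dil hr0 p).trans h₁)
  rw [hH r hr0] at h₂
  have h₃ : r ^ d * energy a K p ^ (d / (2 * a)) = 1 := by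
    rw [hr, ← Real.rpow_mul hE.le, ← Real.rpow_add hE]
    have : -(1 / (2 * a)) * d + d / (2 * a) = 0 := by ring
    rw [this, Real.rpow_zero]
  calc H p = (r ^ d * H p) * energy a K p ^ (d / (2 * a)) := by linear_combination (-H p) * h₃
    _ ≤ _ := by gcongr

end Energy

/-- Small-time stability of `ẋ₁ = |x₁| ^ ν x₂`, `ẋ₂ = u(x₁, x₂)` for a continuous feedback `u` that
is homogeneous of degree `a + κ` for the weights `(1, a)`, strictly decreasing in `x₂`, and reduces
to `-K ⌊x₁⌉ ^ (a + κ)` for `x₂ = 0`. -/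
theorem smallTimeStable_of_homogeneous {ν a κ K : ℝ} {u : ℝ × ℝ → ℝ} (hν : 0 ≤ ν) (ha : 0 < a)
    (ha1 : a < 1) (hκ : κ < 0) (haκ : 0 < a + κ) (hdeg : κ = a - 1 + ν) (hK : 0 < K)
    (hu : Continuous u)
    (hhom : ∀ r : ℝ, 0 < r → ∀ p : ℝ × ℝ, u (r * p.1, r ^ a * p.2) = r ^ (a + κ) * u p)
    (hu0 : ∀ x, u (x, 0) = -K * spow x (a + κ)) (hanti : ∀ x, StrictAnti fun y => u (x, y)) :
    SmallTimeStable (fun p : ℝ × ℝ => (|p.1| ^ ν * p.2, u p)) := by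
  set q : ℝ := (1 + a) / (2 * a) with hq
  have hq1 : 1 < q := by rw [hq, lt_div_iff₀ (by positivity)]; linarith
  set g : ℝ × ℝ → ℝ := fun p =>
    q * energy a K p ^ (q - 1) * (p.2 * (u p - u (p.1, 0))) with hg
  set h : ℝ × ℝ → ℝ := fun p => |p.1| ^ ν * p.2 ^ 2 + p.1 * u p with hh
  have hEc : Continuous (energy a K) := continuous_energy ha
  have hgc : Continuous g := by
    have h₁ : Continuous fun p => energy a K p ^ (q - 1) :=
      hEc.rpow_const fun _ => Or.inr (by linarith)
    fun_prop
  have hhc : Continuous h := by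
    have h₁ : Continuous fun p : ℝ × ℝ => |p.1| ^ ν :=
      continuous_fst.abs.rpow_const fun _ => Or.inr hν
    fun_prop
  have hdiss : ∀ p : ℝ × ℝ, p.2 * (u p - u (p.1, 0)) ≤ 0 := by
    rintro ⟨x, y⟩
    rcases le_total 0 y with hy | hy
    · exact mul_nonpos_of_nonneg_of_nonpos hy (sub_nonpos.mpr ((hanti x).antitone hy))
    · exact mul_nonpos_of_nonpos_of_nonneg hy (sub_nonneg.mpr ((hanti x).antitone hy))
  have hgneg : ∀ p, g p ≤ 0 := fun p => by
    have := energy_nonneg (a := a) ha hK p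
    exact mul_nonpos_of_nonneg_of_nonpos (by positivity) (hdiss p)
  have hgh : ∀ p, energy a K p = 1 → g p = 0 → h p < 0 := by
    rintro ⟨x, y⟩ hE hgp
    simp only [hg, hE, Real.one_rpow, mul_one] at hgp
    have hy : y = 0 := by
      rcases mul_eq_zero.mp ((mul_eq_zero.mp hgp).resolve_left (by positivity)) with h0 | h0
      · exact h0
      · exact (hanti x).injective (sub_eq_zero.mp h0)
    subst hy
    have hx : x ≠ 0 := by
      rintro rfl
      exact zero_ne_one ((energy_zero ha).symm.trans hE)
    have h₁ : h (x, 0) = -K * |x| ^ (1 + (a + κ)) := by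
      simp only [hh, hu0, ← mul_spow_self haκ]; ring
    rw [h₁]
    have : 0 < |x| ^ (1 + (a + κ)) := Real.rpow_pos_of_pos (abs_pos.mpr hx) _
    nlinarith
  have hS := isCompact_energy_eq_one (a := a) ha hK
  obtain ⟨M, hM⟩ := hS.exists_bound_of_continuousOn
    (f := fun p : ℝ × ℝ => p.1 * p.2) (by fun_prop)
  obtain ⟨δ, hδ, hδM, c, hc, hcS⟩ := hS.exists_pos_add_mul_le_neg hgc hhc
    (fun p _ => hgneg p) hgh (δ₀ := 1 / (2 * (|M| + 1))) (by positivity)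
  set V : ℝ × ℝ → ℝ := fun p => energy a K p ^ q + δ * (p.1 * p.2) with hV
  set d : ℝ := 1 + a + κ with hd
  have hcross : ∀ p : ℝ × ℝ, |δ * (p.1 * p.2)| ≤ 1 / 2 * energy a K p ^ q := by
    intro p
    rcases eq_or_ne p 0 with rfl | hp
    · simp [energy_zero ha, Real.zero_rpow (by positivity : q ≠ 0)]
    refine le_mul_energy_rpow (d := 1 + a) ha hK (H := fun p => |δ * (p.1 * p.2)|) ?_ ?_ hp
    · intro r hr p
      have : δ * (r * p.1 * (r ^ a * p.2)) = r ^ (1 + a) * (δ * (p.1 * p.2)) := by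
        rw [Real.rpow_add hr, Real.rpow_one]; ring
      simp only
      rw [this, abs_mul, abs_of_pos (by positivity)]
    · intro p hp
      have h₁ : |p.1 * p.2| ≤ |M| + 1 := (hM p hp).trans ((le_abs_self M).trans (by linarith))
      have h₂ := (le_div_iff₀ (by positivity)).mp hδM
      rw [abs_mul, abs_of_pos hδ]
      nlinarith [mul_le_mul_of_nonneg_left h₁ hδ.le]
  have hdecay : ∀ p, g p + δ * h p ≤ -c * energy a K p ^ (d / (2 * a)) := by
    intro p
    rcases eq_or_ne p 0 with rfl | hp
    · have : d / (2 * a) ≠ 0 := (div_pos (by linarith) (by positivity)).ne'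
      simp [hg, hh, energy_zero ha, Real.zero_rpow this]
    refine le_mul_energy_rpow ha hK (H := fun p => g p + δ * h p) ?_ hcS hp
    intro r hr p
    have h₀ : u (r * p.1, 0) = r ^ (a + κ) * u (p.1, 0) := by
      simpa using hhom r hr (p.1, 0)
    have hE : energy a K (r * p.1, r ^ a * p.2) ^ (q - 1)
        = r ^ (1 - a) * energy a K p ^ (q - 1) := by
      rw [energy_dil hr, Real.mul_rpow (by positivity) (energy_nonneg ha hK p),
        ← Real.rpow_mul hr.le]
      congr 2
      rw [hq]; field_simp; ring
    have hr₁ : r ^ (1 - a) * r ^ a * r ^ (a + κ) = r ^ d := by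
      rw [← Real.rpow_add hr, ← Real.rpow_add hr]; congr 1; rw [hd]; ring
    have hr₂ : r ^ ν * (r ^ a) ^ 2 = r ^ d := by
      rw [sq, ← Real.rpow_add hr, ← Real.rpow_add hr]; congr 1; rw [hd, hdeg]; ring
    have hr₃ : r * r ^ (a + κ) = r ^ d := by
      rw [hd, add_assoc, Real.rpow_add hr 1, Real.rpow_one]
    simp only [hg, hh, hE, hhom r hr, h₀, abs_mul, abs_of_pos hr,
      Real.mul_rpow hr.le (abs_nonneg _)]
    linear_combination (q * energy a K p ^ (q - 1) * (p.2 * (u p - u (p.1, 0)))) * hr₁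
      + δ * |p.1| ^ ν * p.2 ^ 2 * hr₂ + δ * p.1 * u p * hr₃
  set θ : ℝ := d / (1 + a) with hθ
  have hθ0 : 0 < θ := div_pos (by linarith) (by linarith)
  have hθ1 : θ < 1 := by rw [hθ, div_lt_one (by linarith)]; linarith
  have hVlow : ∀ p, 1 / 2 * energy a K p ^ q ≤ V p := fun p => by
    have := neg_le_of_abs_le (hcross p)
    simp only [hV]; linarith
  have hVup : ∀ p, 2 / 3 * V p ≤ energy a K p ^ q := fun p => by
    have := le_of_abs_le (hcross p)
    simp only [hV]; linarith
  have hV0 : ∀ p, 0 ≤ V p := fun p => le_trans (by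
    have := energy_nonneg (a := a) ha hK p
    positivity) (hVlow p)
  have hVdecay : ∀ p, g p + δ * h p ≤ -(c * (2 / 3) ^ θ) * V p ^ θ := by
    intro p
    have h₁ : (2 / 3) ^ θ * V p ^ θ ≤ energy a K p ^ (d / (2 * a)) := by
      rw [← Real.mul_rpow (by norm_num) (hV0 p)]
      refine (Real.rpow_le_rpow (mul_nonneg (by norm_num) (hV0 p)) (hVup p) hθ0.le).trans_eq ?_
      rw [← Real.rpow_mul (energy_nonneg ha hK p)]
      congr 1
      rw [hq, hθ]; field_simp
    nlinarith [hdecay p, mul_le_mul_of_nonneg_left h₁ hc.le]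
  have hVc : Continuous V := by
    have h₁ : Continuous fun p => energy a K p ^ q :=
      hEc.rpow_const fun _ => Or.inr (by linarith)
    fun_prop
  intro ε hε
  have hEs : ∀ᶠ p in nhds (0 : ℝ × ℝ),
      energy a K p < min (ε ^ 2 / 2) (K / (2 * a) * ε ^ (2 * a)) :=
    hEc.continuousAt.eventually_lt_const (by rw [energy_zero ha]; positivity)
  have hVs : ∀ᶠ p in nhds (0 : ℝ × ℝ), V p ^ (1 - θ) < (1 - θ) * (c * (2 / 3) ^ θ) * ε := by
    have hcont : Continuous fun p => V p ^ (1 - θ) :=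
      hVc.rpow_const fun _ => Or.inr (by linarith)
    have hθ' : 0 < 1 - θ := by linarith
    have hzero : V 0 = 0 := by simp [hV, energy_zero ha, Real.zero_rpow (by positivity : q ≠ 0)]
    refine hcont.continuousAt.eventually_lt_const ?_
    simp only [hzero, Real.zero_rpow hθ'.ne']
    positivity
  obtain ⟨η, hη, hηs⟩ := Metric.eventually_nhds_iff.mp (hEs.and hVs)
  refine ⟨η, hη, fun x hx hx0 => ?_⟩
  obtain ⟨hE0, hV00⟩ := hηs (by simpa using hx0)
  have hxc : ContinuousOn x (Ici 0) := fun t ht => (hx t ht).continuousWithinAt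
  have hx₁ : ∀ t ∈ Ici (0 : ℝ),
      HasDerivWithinAt (fun s => (x s).1) (|(x t).1| ^ ν * (x t).2) (Ici 0) t := fun t ht =>
    (ContinuousLinearMap.fst ℝ ℝ ℝ).hasFDerivAt.comp_hasDerivWithinAt t (hx t ht)
  have hx₂ : ∀ t ∈ Ici (0 : ℝ), HasDerivWithinAt (fun s => (x s).2) (u (x t)) (Ici 0) t :=
    fun t ht => (ContinuousLinearMap.snd ℝ ℝ ℝ).hasFDerivAt.comp_hasDerivWithinAt t (hx t ht)
  have hE' : ∀ t, 0 ≤ t → HasDerivWithinAt (fun s => energy a K (x s))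
      ((x t).2 * (u (x t) - u ((x t).1, 0))) (Ici t) t := by
    intro t ht
    have h₁ := hasDerivWithinAt_abs_rpow (q := 2 * a) (by positivity) (by linarith) hx₁
      (continuous_snd.comp_continuousOn hxc) ht
    have h₂ := (hx₂ t ht).mono (Ici_subset_Ici.mpr ht)
    refine (((h₂.pow 2).div_const 2).add (h₁.const_mul (K / (2 * a)))).congr_deriv ?_
    have he : 2 * a - 1 + ν = a + κ := by rw [hdeg]; ring
    rw [hu0, he]
    field_simp
    simp
    ring
  have hV' : ∀ t, 0 ≤ t → HasDerivWithinAt (fun s => V (x s))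
      (g (x t) + δ * h (x t)) (Ici t) t := by
    intro t ht
    have h₁ := (hx₁ t ht).mono (Ici_subset_Ici.mpr ht)
    have h₂ := (hx₂ t ht).mono (Ici_subset_Ici.mpr ht)
    refine (((hE' t ht).rpow_const (p := q) (Or.inr hq1.le)).add
      ((h₁.mul h₂).const_mul δ)).congr_deriv ?_
    simp only [hg, hh]
    ring
  constructor
  · have hVε := eq_zero_of_right_deriv_le_neg_rpow (f := fun s => V (x s)) (by positivity) hθ1 hε.le
      (hVc.comp_continuousOn hxc) hV' (fun t _ => hV0 _) (fun t _ => hVdecay _) hV00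
    by_contra hne
    have := energy_pos (a := a) ha hK hne
    have h₁ : 0 < 1 / 2 * energy a K (x ε) ^ q := by positivity
    exact absurd (hVlow (x ε)) (by rw [hVε]; exact not_le.mpr h₁)
  · intro t ht
    exact norm_lt_of_energy_lt ha hK hε ((le_of_right_deriv_nonpos
      (hEc.comp_continuousOn hxc) hE' (fun s _ => hdiss _) le_rfl ht).trans_lt hE0)

/-- Small-time stabilization of the modified double integrator
`ẋ₁ = |x₁|^ν x₂, ẋ₂ = u` by
`u = -k₂⌊⌊x₂⌉^l - ⌊x̄₂⌉^l⌉^{(1+2κ-ν)/(l(1+κ-ν))}` with `x̄₂ = -k₁⌊x₁⌉^{1+κ-ν}`. -/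
theorem stmt9 (ν κ l k₁ k₂ : ℝ) (hν : ν ∈ Set.Ico (0:ℝ) 1)
    (hκ₁ : -(1-ν)/2 < κ) (hκ₂ : κ < 0)
    (hl : 1/(1+κ-ν) < l) (hk₁ : 0 < k₁) (hk₂ : hGain l κ ν k₁ < k₂) :
    SmallTimeStable (fun p : ℝ × ℝ =>
      (|p.1| ^ ν * p.2,
       -k₂ * spow (spow p.2 l - spow (-k₁ * spow p.1 (1+κ-ν)) l)
         ((1 + 2*κ - ν) / (l * (1+κ-ν))))) := by
  obtain ⟨hν0, hν1⟩ := hν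
  have ha : 0 < 1 + κ - ν := by linarith
  have hb : 0 < 1 + 2 * κ - ν := by linarith
  have hl0 : 0 < l := (by positivity : 0 < 1 / (1 + κ - ν)).trans hl
  have hgain : 0 < (l + 1) * (1 + κ - ν) + κ := by nlinarith [mul_pos hl0 ha]
  have hk₂0 : 0 < k₂ := lt_trans (by unfold hGain; positivity) hk₂
  have hexp : 0 < (1 + 2 * κ - ν) / (l * (1 + κ - ν)) := by positivity
  have hdegree : (1 + κ - ν) * l * ((1 + 2 * κ - ν) / (l * (1 + κ - ν))) = 1 + κ - ν + κ := by
    field_simp; ring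
  refine smallTimeStable_of_homogeneous (a := 1 + κ - ν) (κ := κ)
    (K := k₂ * (k₁ ^ l) ^ ((1 + 2 * κ - ν) / (l * (1 + κ - ν)))) hν0 ha (by linarith) hκ₂
    (by linarith) (by ring) (by positivity) ?_ ?_ ?_ ?_
  · have h₁ := continuous_spow ha
    have h₂ := continuous_spow hl0
    have h₃ := continuous_spow hexp
    exact continuous_const.mul (h₃.comp ((h₂.comp continuous_snd).sub
      (h₂.comp (continuous_const.mul (h₁.comp continuous_fst)))))
  · intro r hr p
    have h₁ : -k₁ * (r ^ (1 + κ - ν) * spow p.1 (1 + κ - ν))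
        = r ^ (1 + κ - ν) * (-k₁ * spow p.1 (1 + κ - ν)) := by ring
    simp only
    rw [spow_mul_of_pos hr, h₁, spow_mul_of_pos (by positivity), spow_mul_of_pos (by positivity),
      ← mul_sub, spow_mul_of_pos (by positivity), ← Real.rpow_mul hr.le, ← Real.rpow_mul hr.le,
      hdegree]
    ring
  · intro x
    simp only
    rw [spow_zero_left, zero_sub, neg_mul k₁, spow_neg_left _ l, neg_neg, spow_mul_of_pos hk₁,
      spow_mul_of_pos (by positivity), spow_spow, spow_spow, ← mul_assoc (1 + κ - ν), hdegree]
    ring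
  · intro x y z hyz
    exact mul_lt_mul_of_neg_left (strictMono_spow hexp
      (sub_lt_sub_right (strictMono_spow hl0 hyz) _)) (by linarith)
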